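/- Let P(x) = (1−x)(1−tx)(1−t^{-1}x). Then the contour integral (1/2)∮_{|z|=1} (dz/2πiz) · (1−z²)(1−z^{-2}) · (1−q^{-2})(1−q^{-2}z²)(1−q^{-2}z^{-2}) / (P(zq^{-1})P(z^{-1}q^{-1})), for complex parameters with |q| sufficiently large and |t| = 1, equals 1 + tq^{-2} + q^{-2} + t^{-1}q^{-2}. Equivalently, as an identity of formal power series in q^{-1} with coefficients in ℤ[t, t^{-1}]: the constant term in z (after symmetrization by the residue computation at the poles z = 0, z = 1/(qt), z = t/q inside the unit circle) of the above rational function is the polynomial 1 + (t + 1 + t^{-1})q^{-2}. -/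

import Mathlib

open Complex in
/-- Inversion `z ↦ z⁻¹` preserves the measure `dz / z` on the unit circle. -/
theorem circleIntegral_comp_inv_div (f : ℂ → ℂ) :
    (∮ z in C((0 : ℂ), 1), f z⁻¹ / z) = ∮ z in C((0 : ℂ), 1), f z / z := by
  have key (g : ℂ → ℂ) : (∮ z in C((0 : ℂ), 1), g z / z) =
      ∫ θ in (0 : ℝ)..2 * Real.pi, I * g (circleMap 0 1 θ) := by
    refine intervalIntegral.integral_congr fun θ _ => ?_
    have h : circleMap 0 1 θ ≠ 0 := circleMap_ne_center one_ne_zero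
    simp only [deriv_circleMap, smul_eq_mul]
    field_simp
  have hinv (θ : ℝ) : (circleMap 0 1 θ)⁻¹ = circleMap 0 1 (-θ) := by
    simp [circleMap, ← Complex.exp_neg]
  rw [key, key]
  simp only [hinv]
  rw [intervalIntegral.integral_comp_neg (fun θ => I * f (circleMap 0 1 θ))]
  have hper : Function.Periodic (fun θ => I * f (circleMap 0 1 θ)) (2 * Real.pi) := fun θ => by
    simp only [periodic_circleMap 0 1 θ]
  simpa using hper.intervalIntegral_add_eq (-(2 * Real.pi)) 0

/-- The polynomial `N` in the decomposition of Weyl's integrand as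
`2c + z N(z) / D(z) + z⁻¹ N(z⁻¹) / D(z⁻¹)`, with `D(z) = (1 - t s z) (1 - t⁻¹ s z)`
and `e = t + t⁻¹`. -/
def weylNumerator (s e z : ℂ) : ℂ :=
  (s - s ^ 3 + e * s * (1 + s ^ 2 + e * s ^ 2)) - (1 + s ^ 2) * (1 + s ^ 2 + e * s ^ 2) * z -
    s * (1 - s ^ 2) * z ^ 2

/-- The part of Weyl's integrand that is holomorphic on the closed unit disc, divided by `z`. -/
noncomputable def weylHolomorphicPart (s t z : ℂ) : ℂ :=
  weylNumerator s (t + t⁻¹) z / ((1 - t * (z * s)) * (1 - t⁻¹ * (z * s)))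

theorem weyl_integrand_decomposition {s t z : ℂ} (ht : t ≠ 0) (hz : z ≠ 0)
    (h₁ : 1 - z * s ≠ 0) (h₂ : 1 - t * (z * s) ≠ 0) (h₃ : 1 - t⁻¹ * (z * s) ≠ 0)
    (h₄ : 1 - z⁻¹ * s ≠ 0) (h₅ : 1 - t * (z⁻¹ * s) ≠ 0) (h₆ : 1 - t⁻¹ * (z⁻¹ * s) ≠ 0) :
    (1 - z ^ 2) * (1 - z⁻¹ ^ 2) *
        ((1 - s ^ 2) * (1 - s ^ 2 * z ^ 2) * (1 - s ^ 2 * z⁻¹ ^ 2)) /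
        (((1 - z * s) * (1 - t * (z * s)) * (1 - t⁻¹ * (z * s))) *
          ((1 - z⁻¹ * s) * (1 - t * (z⁻¹ * s)) * (1 - t⁻¹ * (z⁻¹ * s)))) =
      2 * (1 + t * s ^ 2 + s ^ 2 + t⁻¹ * s ^ 2) + z * weylHolomorphicPart s t z +
        z⁻¹ * weylHolomorphicPart s t z⁻¹ := by
  have hnum : (1 - z ^ 2) * (1 - z⁻¹ ^ 2) *
      ((1 - s ^ 2) * (1 - s ^ 2 * z ^ 2) * (1 - s ^ 2 * z⁻¹ ^ 2)) =
      (1 - z * s) * (1 - z⁻¹ * s) *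
        (2 * (1 + t * s ^ 2 + s ^ 2 + t⁻¹ * s ^ 2) *
            ((1 - t * (z * s)) * (1 - t⁻¹ * (z * s))) *
            ((1 - t * (z⁻¹ * s)) * (1 - t⁻¹ * (z⁻¹ * s))) +
          z * weylNumerator s (t + t⁻¹) z * ((1 - t * (z⁻¹ * s)) * (1 - t⁻¹ * (z⁻¹ * s))) +
          z⁻¹ * weylNumerator s (t + t⁻¹) z⁻¹ * ((1 - t * (z * s)) * (1 - t⁻¹ * (z * s)))) := by
    unfold weylNumerator
    field_simp
    ring
  rw [hnum]
  unfold weylHolomorphicPart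
  generalize 1 - z * s = a₁ at *
  generalize 1 - t * (z * s) = a₂ at *
  generalize 1 - t⁻¹ * (z * s) = a₃ at *
  generalize 1 - z⁻¹ * s = a₄ at *
  generalize 1 - t * (z⁻¹ * s) = a₅ at *
  generalize 1 - t⁻¹ * (z⁻¹ * s) = a₆ at *
  field_simp

theorem one_sub_ne_zero_of_norm_lt_one {x : ℂ} (hx : ‖x‖ < 1) : 1 - x ≠ 0 := by
  rw [sub_ne_zero]
  rintro rfl
  simp at hx

theorem differentiableAt_weylHolomorphicPart {s t z : ℂ} (hs : ‖s‖ < 1) (ht : ‖t‖ = 1)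
    (hz : ‖z‖ ≤ 1) : DifferentiableAt ℂ (weylHolomorphicPart s t) z := by
  have hzs : ‖z * s‖ < 1 := by
    rw [norm_mul]
    exact (mul_le_of_le_one_left (norm_nonneg s) hz).trans_lt hs
  unfold weylHolomorphicPart weylNumerator
  refine DifferentiableAt.fun_div (by fun_prop) (by fun_prop) (mul_ne_zero ?_ ?_) <;>
    exact one_sub_ne_zero_of_norm_lt_one (by simpa [ht] using hzs)


/-- with `P(x) = (1−x)(1−tx)(1−t⁻¹x)`, for `|t| = 1` and `|q|` sufficiently
large, Weyl's integration formula computation: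
`(1/2)∮_{|z|=1} (dz/2πiz)·(1−z²)(1−z⁻²)·(1−q⁻²)(1−q⁻²z²)(1−q⁻²z⁻²)/(P(zq⁻¹)P(z⁻¹q⁻¹))`
equals `1 + tq⁻² + q⁻² + t⁻¹q⁻²`. -/
theorem stmt16 :
    ∃ Q : ℝ, 1 ≤ Q ∧ ∀ q t : ℂ, Q < ‖q‖ → ‖t‖ = 1 →
      (1 / 2 : ℂ) * (2 * (Real.pi : ℂ) * Complex.I)⁻¹ *
        (∮ z in C((0 : ℂ), 1),
          ((1 - z ^ 2) * (1 - z⁻¹ ^ 2) *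
            ((1 - q⁻¹ ^ 2) * (1 - q⁻¹ ^ 2 * z ^ 2) * (1 - q⁻¹ ^ 2 * z⁻¹ ^ 2)) /
            (((1 - z * q⁻¹) * (1 - t * (z * q⁻¹)) * (1 - t⁻¹ * (z * q⁻¹))) *
              ((1 - z⁻¹ * q⁻¹) * (1 - t * (z⁻¹ * q⁻¹)) * (1 - t⁻¹ * (z⁻¹ * q⁻¹))))) / z)
      = 1 + t * q⁻¹ ^ 2 + q⁻¹ ^ 2 + t⁻¹ * q⁻¹ ^ 2 := by
  refine ⟨1, le_rfl, fun q t hq ht => ?_⟩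
  have hs : ‖q⁻¹‖ < 1 := by
    rw [norm_inv]
    exact inv_lt_one_of_one_lt₀ hq
  generalize q⁻¹ = s at hs ⊢
  have ht₀ : t ≠ 0 := norm_ne_zero_iff.mp (by simp [ht])
  set H := weylHolomorphicPart s t
  set c : ℂ := 1 + t * s ^ 2 + s ^ 2 + t⁻¹ * s ^ 2
  have hdiff (z : ℂ) (hz : ‖z‖ ≤ 1) : DifferentiableAt ℂ H z :=
    differentiableAt_weylHolomorphicPart hs ht hz
  have hH : (∮ z in C((0 : ℂ), 1), z * H z / z) = 0 := by
    rw [circleIntegral.integral_congr (g := H) zero_le_one fun z hz =>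
      mul_div_cancel_left₀ _ (ne_zero_of_mem_unit_sphere ⟨z, hz⟩)]
    refine Complex.circleIntegral_eq_zero_of_differentiable_on_off_countable zero_le_one
      Set.countable_empty (fun z hz => ?_) fun z hz => ?_
    · exact (hdiff z (by simpa using hz)).continuousAt.continuousWithinAt
    · exact hdiff z (by simpa using (Metric.ball_subset_closedBall hz.1))
  have hH_inv : (∮ z in C((0 : ℂ), 1), z⁻¹ * H z⁻¹ / z) = 0 :=
    (circleIntegral_comp_inv_div fun z => z * H z).trans hH
  have hconst : (∮ z in C((0 : ℂ), 1), 2 * c / z) = 2 * c * (2 * Real.pi * Complex.I) := by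
    have := circleIntegral.integral_sub_center_inv (0 : ℂ) one_ne_zero
    simp only [sub_zero] at this
    simp only [div_eq_mul_inv, circleIntegral.integral_const_mul, this]
  have hint : (∮ z in C((0 : ℂ), 1),
      (2 * c / z + z * H z / z) + z⁻¹ * H z⁻¹ / z) = 2 * c * (2 * Real.pi * Complex.I) := by
    have hne {z : ℂ} (hz : z ∈ Metric.sphere (0 : ℂ) 1) : z ≠ 0 :=
      ne_zero_of_mem_unit_sphere ⟨z, hz⟩
    have hcont : ContinuousOn (fun z => 2 * c / z) (Metric.sphere (0 : ℂ) 1) :=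
      continuousOn_const.div continuousOn_id fun z hz => hne hz
    have hcontH : ContinuousOn (fun z => z * H z / z) (Metric.sphere (0 : ℂ) 1) := fun z hz =>
      ((continuousAt_id.mul (hdiff z (by simp_all)).continuousAt).div continuousAt_id
        (hne hz)).continuousWithinAt
    have hcontH_inv : ContinuousOn (fun z => z⁻¹ * H z⁻¹ / z) (Metric.sphere (0 : ℂ) 1) :=
      fun z hz => by
        have hinv : ContinuousAt (fun z : ℂ => z⁻¹) z := continuousAt_inv₀ (hne hz)
        have hcomp : ContinuousAt (fun z : ℂ => H z⁻¹) z :=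
          ContinuousAt.comp (g := H) (hdiff z⁻¹ (by simp_all)).continuousAt hinv
        exact ((hinv.mul hcomp).div continuousAt_id (hne hz)).continuousWithinAt
    rw [circleIntegral.integral_add ((hcont.fun_add hcontH).circleIntegrable zero_le_one)
        (hcontH_inv.circleIntegrable zero_le_one),
      circleIntegral.integral_add (hcont.circleIntegrable zero_le_one)
        (hcontH.circleIntegrable zero_le_one), hconst, hH, hH_inv, add_zero, add_zero]
  rw [circleIntegral.integral_congr zero_le_one fun z hz => ?_, hint]
  · field_simp
  · have hz₁ : ‖z‖ = 1 := by simpa using hz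
    have hz₀ : z ≠ 0 := norm_ne_zero_iff.mp (by simp [hz₁])
    simp only [← add_div]
    congr 1
    exact weyl_integrand_decomposition ht₀ hz₀
      (one_sub_ne_zero_of_norm_lt_one (by simpa [hz₁] using hs))
      (one_sub_ne_zero_of_norm_lt_one (by simpa [hz₁, ht] using hs))
      (one_sub_ne_zero_of_norm_lt_one (by simpa [hz₁, ht] using hs))
      (one_sub_ne_zero_of_norm_lt_one (by simpa [hz₁] using hs))
      (one_sub_ne_zero_of_norm_lt_one (by simpa [hz₁, ht] using hs))
      (one_sub_ne_zero_of_norm_lt_one (by simpa [hz₁, ht] using hs))
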